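/- arXiv:1305.4822 — 5 statements merged into one kernel-verified Lean document; each statement's English description precedes it below -/
import Mathlib

section
/- Let k ≥ 1, N ≥ 2k+1, and let λ_1, …, λ_k be real numbers with λ_i ≠ −1 for every i. Then the diagonal metric Θ = Θ^{(diag)} intertwines the Hamiltonian with its transpose: Hᵀ · Θ = Θ · H, where H = H^{(N)}(λ_1,…,λ_k). -/
open Matrix BigOperators

noncomputable section

/-- `f(x) := (1-x)/(1+x)`. -/
def metricFactor (x : ℝ) : ℝ := (1 - x) / (1 + x)

/-- The discrete square-well Hamiltonian `H^{(N)}(λ₁,…,λ_k)` (indices here are 0-based;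
the 1-based row index of the paper is `i.val + 1`). -/
def Ham (N k : ℕ) (lam : ℕ → ℝ) : Matrix (Fin N) (Fin N) ℝ :=
  Matrix.of fun i j =>
    if i.val = j.val then 2
    else if j.val = i.val + 1 then
      (if i.val + 1 ≤ k then -1 - lam (i.val + 1)
       else if i.val + 1 < N - k then -1
       else -1 + lam (N - (i.val + 1)))
    else if i.val = j.val + 1 then
      (if j.val + 1 ≤ k then -1 + lam (j.val + 1)
       else if j.val + 1 < N - k then -1
       else -1 - lam (N - (j.val + 1)))
    else 0

/-- The `j`-th (1-based) diagonal entry of the diagonal metric `Θ^{(diag)}`. -/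
def thetaEntry (N k : ℕ) (lam : ℕ → ℝ) (j : ℕ) : ℝ :=
  if j ≤ k then ∏ i ∈ Finset.Icc j k, metricFactor (lam i)
  else if j ≤ N - k then 1
  else ∏ i ∈ Finset.Icc (N + 1 - j) k, metricFactor (lam i)

/-- The diagonal metric `Θ^{(diag)}`. -/
def ThetaDiag (N k : ℕ) (lam : ℕ → ℝ) : Matrix (Fin N) (Fin N) ℝ :=
  Matrix.diagonal fun i => thetaEntry N k lam (i.val + 1)

theorem prod_metricFactor_Icc_mul (k m : ℕ) (lam : ℕ → ℝ) (hm : m ≤ k) (h : lam m ≠ -1) :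
    (-1 - lam m) * ∏ i ∈ Finset.Icc m k, metricFactor (lam i) =
      (-1 + lam m) * ∏ i ∈ Finset.Icc (m + 1) k, metricFactor (lam i) := by
  have hne : 1 + lam m ≠ 0 := fun h0 => h (by linarith)
  have hf : (-1 - lam m) * metricFactor (lam m) = -1 + lam m := by
    unfold metricFactor
    field_simp
    ring
  rw [← Finset.mul_prod_Ioc_eq_prod_Icc hm, ← mul_assoc, hf]
  congr 2
  ext i
  simp only [Finset.mem_Ioc, Finset.mem_Icc, Nat.succ_le_iff]

theorem thetaEntry_of_le_add_one {N k j : ℕ} (lam : ℕ → ℝ) (hN : 2 * k + 1 ≤ N)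
    (hj : j ≤ k + 1) :
    thetaEntry N k lam j = ∏ i ∈ Finset.Icc j k, metricFactor (lam i) := by
  unfold thetaEntry
  split_ifs with h1 h2
  · rfl
  · rw [Finset.Icc_eq_empty (by omega), Finset.prod_empty]
  · omega

theorem thetaEntry_of_sub_le {N k j : ℕ} (lam : ℕ → ℝ) (hN : 2 * k + 1 ≤ N)
    (hj : N - k ≤ j) :
    thetaEntry N k lam j = ∏ i ∈ Finset.Icc (N + 1 - j) k, metricFactor (lam i) := by
  unfold thetaEntry
  split_ifs with h1 h2
  · omega
  · rw [Finset.Icc_eq_empty (by omega), Finset.prod_empty]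
  · rfl

theorem thetaEntry_mul_Ham_succ (k N : ℕ) (hN : 2 * k + 1 ≤ N) (lam : ℕ → ℝ)
    (hlam : ∀ i, 1 ≤ i → i ≤ k → lam i ≠ -1) (i j : Fin N) (hij : j.val = i.val + 1) :
    thetaEntry N k lam (i.val + 1) * Ham N k lam i j =
      thetaEntry N k lam (j.val + 1) * Ham N k lam j i := by
  have hjN := j.isLt
  have hne : i.val ≠ j.val := by omega
  have hne' : i.val ≠ j.val + 1 := by omega
  simp only [Ham, Matrix.of_apply, if_neg hne, if_neg hne.symm, if_neg hne', if_pos hij]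
  by_cases h1 : i.val + 1 ≤ k
  · rw [if_pos h1, if_pos h1, thetaEntry_of_le_add_one lam hN (by omega),
      thetaEntry_of_le_add_one lam hN (by omega), hij]
    linarith [prod_metricFactor_Icc_mul k (i.val + 1) lam h1 (hlam _ (by omega) h1)]
  by_cases h2 : i.val + 1 < N - k
  · simp only [if_neg h1, if_pos h2, thetaEntry, hij]
    rw [if_pos (by omega), if_neg (by omega), if_pos (by omega)]
  · rw [if_neg h1, if_neg h1, if_neg h2, if_neg h2, thetaEntry_of_sub_le lam hN (by omega),
      thetaEntry_of_sub_le lam hN (by omega),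
      show N + 1 - (i.val + 1) = N - (i.val + 1) + 1 by omega,
      show N + 1 - (j.val + 1) = N - (i.val + 1) by omega]
    have hm : N - (i.val + 1) ≤ k := by omega
    linarith [prod_metricFactor_Icc_mul k _ lam hm (hlam _ (by omega) hm)]

/-- for `k ≥ 1`, `N ≥ 2k+1` and real parameters `λ₁,…,λ_k` with `λᵢ ≠ -1`,
the diagonal metric intertwines the Hamiltonian with its transpose:
`Hᵀ ⬝ Θ = Θ ⬝ H`. -/
theorem diag_metric_intertwines (k N : ℕ) (hk : 1 ≤ k) (hN : 2 * k + 1 ≤ N)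
    (lam : ℕ → ℝ) (hlam : ∀ i, 1 ≤ i → i ≤ k → lam i ≠ -1) :
    (Ham N k lam)ᵀ * ThetaDiag N k lam = ThetaDiag N k lam * Ham N k lam := by
  ext i j
  simp only [ThetaDiag, Matrix.mul_diagonal, Matrix.diagonal_mul, Matrix.transpose_apply]
  by_cases hij : j.val = i.val + 1
  · linarith [thetaEntry_mul_Ham_succ k N hN lam hlam i j hij]
  by_cases hji : i.val = j.val + 1
  · linarith [thetaEntry_mul_Ham_succ k N hN lam hlam j i hji]
  by_cases h : i = j
  · subst h
    exact mul_comm _ _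
  · have h' : i.val ≠ j.val := fun e => h (Fin.ext e)
    simp only [Ham, Matrix.of_apply, if_neg hij, if_neg hji, if_neg h', if_neg h'.symm,
      zero_mul, mul_zero]
end
end

section
/- Let k ≥ 1, N ≥ 2k+1, and let λ_1, …, λ_k be real numbers with |λ_i| < 1 for every i. Then H = H^{(N)}(λ_1,…,λ_k) is self-adjoint with respect to the weighted inner product ⟨x,y⟩_Θ := Σ_{j=1}^{N} Θ_{j,j} x_j y_j on ℝ^N; that is, ⟨Hx, y⟩_Θ = ⟨x, Hy⟩_Θ for all x, y ∈ ℝ^N, where Θ = Θ^{(diag)}. -/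
open Matrix BigOperators

noncomputable section

theorem prod_metricFactor_Icc_eq_mul {m k : ℕ} (lam : ℕ → ℝ) (h : m ≤ k) :
    ∏ i ∈ Finset.Icc m k, metricFactor (lam i) =
      metricFactor (lam m) * ∏ i ∈ Finset.Icc (m + 1) k, metricFactor (lam i) := by
  rw [← Finset.insert_Icc_add_one_left_eq_Icc h, Finset.prod_insert (by simp)]

theorem metricFactor_mul_neg_one_sub {x : ℝ} (hx : |x| < 1) :
    metricFactor x * (-1 - x) = -1 + x := by
  have h : 1 + x ≠ 0 := by linarith [(abs_lt.mp hx).1]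
  unfold metricFactor
  field_simp
  ring

theorem thetaEntry_eq_mul_of_le {k N j : ℕ} (hN : 2 * k + 1 ≤ N) (lam : ℕ → ℝ) (hj : j ≤ k) :
    thetaEntry N k lam j = metricFactor (lam j) * thetaEntry N k lam (j + 1) := by
  unfold thetaEntry
  rw [if_pos hj, prod_metricFactor_Icc_eq_mul lam hj]
  by_cases h : j + 1 ≤ k
  · rw [if_pos h]
  · rw [if_neg h, if_pos (by omega), Finset.Icc_eq_empty h, Finset.prod_empty]

theorem thetaEntry_eq_one {k N j : ℕ} (lam : ℕ → ℝ) (hj : k < j) (hj' : j ≤ N - k) :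
    thetaEntry N k lam j = 1 := by
  rw [thetaEntry, if_neg (by omega), if_pos hj']

theorem thetaEntry_add_one_eq_mul_of_ge {k N j : ℕ} (hN : 2 * k + 1 ≤ N) (lam : ℕ → ℝ)
    (hj : N - k ≤ j) (hjN : j < N) :
    thetaEntry N k lam (j + 1) = metricFactor (lam (N - j)) * thetaEntry N k lam j := by
  unfold thetaEntry
  rw [if_neg (by omega), if_neg (by omega), if_neg (by omega),
    show N + 1 - (j + 1) = N - j by omega, prod_metricFactor_Icc_eq_mul lam (by omega)]
  by_cases h : j ≤ N - k
  · rw [if_pos h, Finset.Icc_eq_empty (by omega), Finset.prod_empty]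
  · rw [if_neg h, show N + 1 - j = N - j + 1 by omega]

theorem thetaEntry_mul_ham_of_succ {k N : ℕ} (hN : 2 * k + 1 ≤ N) {lam : ℕ → ℝ}
    (hlam : ∀ i, 1 ≤ i → i ≤ k → |lam i| < 1) {i j : Fin N} (hij : j.val = i.val + 1) :
    thetaEntry N k lam (i.val + 1) * Ham N k lam i j =
      thetaEntry N k lam (j.val + 1) * Ham N k lam j i := by
  have hjN := j.isLt
  have h_ne : i.val ≠ i.val + 1 := by omega
  have h_ne' : i.val ≠ i.val + 1 + 1 := by omega
  simp only [Ham, Matrix.of_apply, hij, if_neg h_ne, if_neg h_ne.symm, if_neg h_ne', if_true]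
  split_ifs with h₁ h₂
  · rw [thetaEntry_eq_mul_of_le hN lam h₁]
    linear_combination thetaEntry N k lam (i.val + 1 + 1) *
      metricFactor_mul_neg_one_sub (hlam _ (by omega) h₁)
  · rw [thetaEntry_eq_one lam (by omega) (by omega), thetaEntry_eq_one lam (by omega) (by omega)]
  · rw [thetaEntry_add_one_eq_mul_of_ge hN lam (j := i.val + 1) (by omega) (by omega)]
    linear_combination -thetaEntry N k lam (i.val + 1) *
      metricFactor_mul_neg_one_sub (hlam (N - (i.val + 1)) (by omega) (by omega))

/-- The product `Θ H` is a symmetric matrix. -/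
theorem thetaEntry_mul_ham_comm {k N : ℕ} (hN : 2 * k + 1 ≤ N) {lam : ℕ → ℝ}
    (hlam : ∀ i, 1 ≤ i → i ≤ k → |lam i| < 1) (i j : Fin N) :
    thetaEntry N k lam (i.val + 1) * Ham N k lam i j =
      thetaEntry N k lam (j.val + 1) * Ham N k lam j i := by
  by_cases h₁ : j.val = i.val + 1
  · exact thetaEntry_mul_ham_of_succ hN hlam h₁
  by_cases h₂ : i.val = j.val + 1
  · exact (thetaEntry_mul_ham_of_succ hN hlam h₂).symm
  by_cases h₃ : i = j
  · rw [h₃]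
  have h₄ : i.val ≠ j.val := fun h => h₃ (Fin.ext h)
  simp [Ham, h₁, h₂, h₄, h₄.symm]

/-- for `k ≥ 1`, `N ≥ 2k+1`, `|λᵢ| < 1`, the Hamiltonian is self-adjoint
with respect to the weighted inner product `⟨x,y⟩_Θ = Σ_j Θ_{j,j} x_j y_j` on `ℝ^N`:
`⟨Hx, y⟩_Θ = ⟨x, Hy⟩_Θ` for all `x, y`. -/
theorem ham_selfAdjoint_weighted (k N : ℕ) (hk : 1 ≤ k) (hN : 2 * k + 1 ≤ N)
    (lam : ℕ → ℝ) (hlam : ∀ i, 1 ≤ i → i ≤ k → |lam i| < 1) :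
    ∀ x y : Fin N → ℝ,
      ∑ j : Fin N, thetaEntry N k lam (j.val + 1) * ((Ham N k lam).mulVec x j) * y j =
      ∑ j : Fin N, thetaEntry N k lam (j.val + 1) * x j * ((Ham N k lam).mulVec y j) := by
  intro x y
  simp only [Matrix.mulVec, dotProduct, Finset.mul_sum, Finset.sum_mul]
  rw [Finset.sum_comm]
  refine Finset.sum_congr rfl fun i _ => Finset.sum_congr rfl fun j _ => ?_
  linear_combination -(x i * y j) * thetaEntry_mul_ham_comm hN hlam i j
end
end

section
/- Let k ≥ 1, N ≥ 2k+1, and let λ_1, …, λ_k be real numbers with |λ_i| < 1 for every i. Then the spectrum of H = H^{(N)}(λ_1,…,λ_k) is entirely real: every complex eigenvalue of H, regarded as a matrix over ℂ (equivalently, every root in ℂ of its characteristic polynomial), is a real number. -/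
open Matrix BigOperators

noncomputable section

open scoped ComplexConjugate in
/-- A real matrix that is symmetrizable by positive weights has real spectrum. -/
theorem Matrix.im_eq_zero_of_mem_spectrum_of_symmetrizable {n : Type*} [Fintype n] [DecidableEq n]
    (A : Matrix n n ℝ) (w : n → ℝ) (hw : ∀ i, 0 < w i)
    (hA : ∀ i j, w i * A i j = w j * A j i) {z : ℂ}
    (hz : z ∈ spectrum ℂ (A.map Complex.ofReal)) : z.im = 0 := by
  rw [← Matrix.spectrum_toLin', ← Module.End.hasEigenvalue_iff_mem_spectrum] at hz
  obtain ⟨v, hv⟩ := hz.exists_hasEigenvector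
  have hmul : ∀ i, ∑ j, (A i j : ℂ) * v j = z * v i := fun i => by
    simpa [Matrix.mulVec, dotProduct] using congrFun hv.apply_eq_smul i
  set S : ℝ := ∑ i, w i * Complex.normSq (v i) with hS
  have hSpos : 0 < S := by
    obtain ⟨i, hi⟩ := Function.ne_iff.mp hv.2
    exact Finset.sum_pos' (fun j _ => mul_nonneg (hw j).le (Complex.normSq_nonneg _))
      ⟨i, Finset.mem_univ i, mul_pos (hw i) (Complex.normSq_pos.mpr hi)⟩
  have hform : z * S = ∑ i, ∑ j, (w i * A i j : ℂ) * (conj (v i) * v j) := by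
    simp only [hS, Complex.ofReal_sum, Complex.ofReal_mul, Finset.mul_sum]
    refine Finset.sum_congr rfl fun i _ => ?_
    rw [Complex.normSq_eq_conj_mul_self]
    calc z * (w i * (conj (v i) * v i)) = w i * conj (v i) * (z * v i) := by ring
      _ = _ := by
        rw [← hmul, Finset.mul_sum]
        exact Finset.sum_congr rfl fun j _ => by ring
  have hconj : conj (z * S) = z * S := by
    rw [hform]
    simp only [map_sum, map_mul, Complex.conj_ofReal, Complex.conj_conj]
    rw [Finset.sum_comm]
    refine Finset.sum_congr rfl fun i _ => Finset.sum_congr rfl fun j _ => ?_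
    have h : (w i * A i j : ℂ) = w j * A j i := by exact_mod_cast hA i j
    rw [h]
    ring
  have him := Complex.conj_eq_iff_im.mp hconj
  rw [Complex.im_mul_ofReal] at him
  exact (mul_eq_zero.mp him).resolve_right hSpos.ne'

/-- A real tridiagonal matrix whose opposite off-diagonal entries have positive ratio `r`
has real spectrum. -/
theorem Matrix.im_eq_zero_of_mem_spectrum_of_tridiagonal {N : ℕ} (A : Matrix (Fin N) (Fin N) ℝ)
    (r : ℕ → ℝ) (hr : ∀ m, m + 1 < N → 0 < r m)
    (hsucc : ∀ i j : Fin N, j.val = i.val + 1 → A i j = r i * A j i)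
    (hzero : ∀ i j : Fin N, i ≠ j → j.val ≠ i.val + 1 → i.val ≠ j.val + 1 → A i j = 0) {z : ℂ}
    (hz : z ∈ spectrum ℂ (A.map Complex.ofReal)) : z.im = 0 := by
  have hstep : ∀ i j : Fin N, j.val = i.val + 1 →
      (∏ m ∈ Finset.range i, r m) * A i j = (∏ m ∈ Finset.range j, r m) * A j i := by
    intro i j h
    rw [hsucc i j h, h, Finset.prod_range_succ, mul_assoc]
  refine A.im_eq_zero_of_mem_spectrum_of_symmetrizable
    (fun i => ∏ m ∈ Finset.range i, r m) (fun i => Finset.prod_pos fun m hm => ?_)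
    (fun i j => ?_) hz
  · have := Finset.mem_range.mp hm
    exact hr m (by omega)
  · by_cases hij : i = j
    · rw [hij]
    by_cases h : j.val = i.val + 1
    · exact hstep i j h
    by_cases h' : i.val = j.val + 1
    · exact (hstep j i h').symm
    · rw [hzero i j hij h h', hzero j i (Ne.symm hij) h' h, mul_zero, mul_zero]

/-- for `k ≥ 1`, `N ≥ 2k+1`, `|λᵢ| < 1`, the spectrum of
`H = H^{(N)}(λ₁,…,λ_k)` is entirely real: every complex eigenvalue of `H`
regarded as a matrix over `ℂ` is a real number. -/
theorem spectrum_real (k N : ℕ) (hk : 1 ≤ k) (hN : 2 * k + 1 ≤ N)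
    (lam : ℕ → ℝ) (hlam : ∀ i, 1 ≤ i → i ≤ k → |lam i| < 1) :
    ∀ z : ℂ, z ∈ spectrum ℂ ((Ham N k lam).map (Complex.ofReal)) → z.im = 0 := by
  intro z hz
  refine (Ham N k lam).im_eq_zero_of_mem_spectrum_of_tridiagonal
    (fun m => if m + 1 ≤ k then (-1 - lam (m + 1)) / (-1 + lam (m + 1))
      else if m + 1 < N - k then 1
      else (-1 + lam (N - (m + 1))) / (-1 - lam (N - (m + 1))))
    (fun m hm => ?_) (fun i j h => ?_) (fun i j hij h h' => ?_) hz
  · split_ifs with h1 h2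
    · have := abs_lt.mp (hlam (m + 1) (by omega) h1)
      exact div_pos_of_neg_of_neg (by linarith) (by linarith)
    · exact one_pos
    · have := abs_lt.mp (hlam (N - (m + 1)) (by omega) (by omega))
      exact div_pos_of_neg_of_neg (by linarith) (by linarith)
  · have hj := j.isLt
    have e1 : i.val ≠ j.val := by omega
    have e2 : i.val ≠ j.val + 1 := by omega
    simp only [Ham, Matrix.of_apply, if_neg e1, if_neg e1.symm, if_pos h, if_neg e2]
    split_ifs with h1 h2
    · have := abs_lt.mp (hlam (i.val + 1) (by omega) h1)
      rw [div_mul_cancel₀ _ (by linarith : -1 + lam (i.val + 1) < 0).ne]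
    · rw [one_mul]
    · have := abs_lt.mp (hlam (N - (i.val + 1)) (by omega) (by omega))
      rw [div_mul_cancel₀ _ (by linarith : -1 - lam (N - (i.val + 1)) < 0).ne]
  · simp [Ham, Fin.val_ne_of_ne hij, h, h']
end
end

section
/- For every real number t, the secular polynomial of H^{(11)}(t,−t,t,−t), i.e. the characteristic polynomial det(E·I − (H − 2I)) of the shifted matrix H − 2I, equals E^{11} − (10 − 8t²)E⁹ + (36 − 58t² + 22t⁴)E⁷ − (56 − 136t² + 104t⁴ − 24t⁶)E⁵ + (35 − 114t² + 132t⁴ − 62t⁶ + 9t⁸)E³ − (6 − 24t² + 36t⁴ − 24t⁶ + 6t⁸)E. -/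
open Matrix Polynomial

noncomputable section

/-- The 11×11 Hamiltonian `H^{(11)}(t,−t,t,−t)` is `H11 t t t t` below (0-based indices):
all diagonal entries `2`, superdiagonal entries (row order) `−1−t, −1+t, −1−t, −1+t, −1, −1,
−1−t, −1+t, −1−t, −1+t`, subdiagonal entries `−1+t, −1−t, −1+t, −1−t, −1, −1, −1+t, −1−t,
−1+t, −1−t`, zero elsewhere. -/
def H11 (l m n r : ℝ) : Matrix (Fin 11) (Fin 11) ℝ :=
  Matrix.of fun i j =>
    if i = j then 2
    else if h : j.val = i.val + 1 then
      ![-1-l, -1+m, -1-n, -1+r, -1, -1, -1-r, -1+n, -1-m, -1+l]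
        ⟨i.val, by have := j.isLt; omega⟩
    else if h' : i.val = j.val + 1 then
      ![-1+l, -1-m, -1+n, -1-r, -1, -1, -1+r, -1-n, -1+m, -1-l]
        ⟨j.val, by have := i.isLt; omega⟩
    else 0

/-- The `n × n` tridiagonal matrix with diagonal `a`, superdiagonal `b` and subdiagonal `c`. -/
def tridiagonal {R : Type*} [Zero R] (a b c : ℕ → R) (n : ℕ) : Matrix (Fin n) (Fin n) R :=
  Matrix.of fun i j =>
    if i.val = j.val then a i
    else if j.val = i.val + 1 then b i
    else if i.val = j.val + 1 then c j
    else 0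

theorem tridiagonal_submatrix_castSucc {R : Type*} [Zero R] (a b c : ℕ → R) (n : ℕ) :
    (tridiagonal a b c (n + 1)).submatrix Fin.castSucc Fin.castSucc = tridiagonal a b c n := by
  ext i j
  simp [tridiagonal]

theorem det_tridiagonal_zero {R : Type*} [CommRing R] (a b c : ℕ → R) :
    (tridiagonal a b c 0).det = 1 := by
  simp

theorem det_tridiagonal_one {R : Type*} [CommRing R] (a b c : ℕ → R) :
    (tridiagonal a b c 1).det = a 0 := by
  simp [tridiagonal]

/-- The three-term recurrence for determinants of tridiagonal matrices. -/
theorem det_tridiagonal_add_two {R : Type*} [CommRing R] (a b c : ℕ → R) (n : ℕ) :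
    (tridiagonal a b c (n + 2)).det =
      a (n + 1) * (tridiagonal a b c (n + 1)).det
      - b n * c n * (tridiagonal a b c n).det := by
  have hminor : ((tridiagonal a b c (n + 2)).submatrix Fin.castSucc
      (Fin.last n).castSucc.succAbove).det = b n * (tridiagonal a b c n).det := by
    rw [Matrix.det_succ_column _ (Fin.last n), Fin.sum_univ_castSucc, Finset.sum_eq_zero]
    · have hsub : ((tridiagonal a b c (n + 2)).submatrix Fin.castSucc
          (Fin.last n).castSucc.succAbove).submatrix (Fin.last n).succAbove
          (Fin.last n).succAbove = tridiagonal a b c n := by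
        ext i j
        simp [tridiagonal, Fin.succAbove, Fin.lt_def]
      rw [hsub]
      simp [tridiagonal, Fin.succAbove]
    · intro i _
      have hi := i.isLt
      have hne : (i : ℕ) ≠ n + 1 := by omega
      have hne' : n ≠ i := by omega
      simp [tridiagonal, Fin.succAbove, hne, hne']
      omega
  rw [Matrix.det_succ_row _ (Fin.last (n + 1)), Fin.sum_univ_castSucc,
    Fin.sum_univ_castSucc, Finset.sum_eq_zero]
  · rw [Fin.succAbove_last, hminor, tridiagonal_submatrix_castSucc]
    have hodd : (-1 : R) ^ (n + 1 + n) = -1 := Odd.neg_one_pow ⟨n, by ring⟩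
    have hne : n ≠ n + 1 + 1 := by omega
    simp [tridiagonal, hodd, hne]
    ring
  · intro i _
    have hi := i.isLt
    have hne : n + 1 ≠ i := by omega
    have hne' : n ≠ i := by omega
    have hne'' : (i : ℕ) ≠ n + 2 := by omega
    simp [tridiagonal, hne, hne', hne'']

theorem charmatrix_H11_sub_two (t : ℝ) :
    (H11 t t t t - 2).charmatrix =
      tridiagonal (fun _ => X)
        (fun k => if k = 4 ∨ k = 5 then 1 else 1 + (-1) ^ k * C t)
        (fun k => if k = 4 ∨ k = 5 then 1 else 1 - (-1) ^ k * C t) 11 := by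
  have htwo : (2 : Matrix (Fin 11) (Fin 11) ℝ) = Matrix.diagonal fun _ => 2 := rfl
  ext1 i j
  rw [Matrix.charmatrix_apply, Matrix.sub_apply, htwo]
  simp only [H11, tridiagonal, Matrix.of_apply, Matrix.diagonal_apply]
  fin_cases i <;> fin_cases j <;> simp <;> ring

/-- Closed form of the eleventh term of the continuant recurrence with weights
`1 - τ ^ 2`, except for the two middle weights, which are `1`. -/
theorem continuant_eleven {R : Type*} [CommRing R] (x τ : R) (u : ℕ → R) (h0 : u 0 = 1)
    (h1 : u 1 = x)
    (hstep : ∀ n, ¬(n = 4 ∨ n = 5) → u (n + 2) = x * u (n + 1) - (1 - τ ^ 2) * u n)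
    (hmid : ∀ n, n = 4 ∨ n = 5 → u (n + 2) = x * u (n + 1) - u n) :
    u 11 = x ^ 11 - (10 - 8 * τ ^ 2) * x ^ 9 + (36 - 58 * τ ^ 2 + 22 * τ ^ 4) * x ^ 7
      - (56 - 136 * τ ^ 2 + 104 * τ ^ 4 - 24 * τ ^ 6) * x ^ 5
      + (35 - 114 * τ ^ 2 + 132 * τ ^ 4 - 62 * τ ^ 6 + 9 * τ ^ 8) * x ^ 3
      - (6 - 24 * τ ^ 2 + 36 * τ ^ 4 - 24 * τ ^ 6 + 6 * τ ^ 8) * x := by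
  rw [hstep 9 (by simp), hstep 8 (by simp), hstep 7 (by simp), hstep 6 (by simp),
    hmid 5 (by simp), hmid 4 (by simp), hstep 3 (by simp), hstep 2 (by simp),
    hstep 1 (by simp), hstep 0 (by simp), h1, h0]
  ring

/-- for every real `t`, the secular polynomial of `H^{(11)}(t,−t,t,−t)`,
i.e. the characteristic polynomial `det(E·I − (H − 2I))` of the shifted matrix `H − 2I`,
equals `E^11 − (10−8t²)E⁹ + (36−58t²+22t⁴)E⁷ − (56−136t²+104t⁴−24t⁶)E⁵
+ (35−114t²+132t⁴−62t⁶+9t⁸)E³ − (6−24t²+36t⁴−24t⁶+6t⁸)E`. -/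
theorem secular_polynomial (t : ℝ) :
    (H11 t t t t - 2).charpoly =
      X ^ 11 - C (10 - 8 * t ^ 2) * X ^ 9 + C (36 - 58 * t ^ 2 + 22 * t ^ 4) * X ^ 7
        - C (56 - 136 * t ^ 2 + 104 * t ^ 4 - 24 * t ^ 6) * X ^ 5
        + C (35 - 114 * t ^ 2 + 132 * t ^ 4 - 62 * t ^ 6 + 9 * t ^ 8) * X ^ 3
        - C (6 - 24 * t ^ 2 + 36 * t ^ 4 - 24 * t ^ 6 + 6 * t ^ 8) * X := by
  rw [Matrix.charpoly, charmatrix_H11_sub_two]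
  set D := fun n => (tridiagonal (fun _ => (X : ℝ[X]))
    (fun k => if k = 4 ∨ k = 5 then 1 else 1 + (-1) ^ k * C t)
    (fun k => if k = 4 ∨ k = 5 then 1 else 1 - (-1) ^ k * C t) n).det with hD
  have h0 : D 0 = 1 := det_tridiagonal_zero _ _ _
  have h1 : D 1 = X := det_tridiagonal_one _ _ _
  have hstep (n : ℕ) (hn : ¬(n = 4 ∨ n = 5)) :
      D (n + 2) = X * D (n + 1) - (1 - C t ^ 2) * D n := by
    have hsq : ((-1 : ℝ[X]) ^ n) ^ 2 = 1 := by rw [← pow_mul, mul_comm, pow_mul]; simp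
    simp only [hD, det_tridiagonal_add_two, if_neg hn]
    linear_combination C t ^ 2 * D n * hsq
  have hmid (n : ℕ) (hn : n = 4 ∨ n = 5) : D (n + 2) = X * D (n + 1) - D n := by
    simp only [hD, det_tridiagonal_add_two, if_pos hn]
    ring
  have hD11 := continuant_eleven X (C t) D h0 h1 hstep hmid
  simp only [map_add, map_sub, map_mul, map_pow, map_ofNat]
  exact hD11
end
end

section
/- For every real number t, the shifted matrix H^{(11)}(t,−t,t,−t) − 2I is singular, i.e. det(H^{(11)}(t,−t,t,−t) − 2I) = 0; equivalently, E = 0 is a t-independent eigenvalue of the shifted Hamiltonian for all values of the coupling t. -/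
open Matrix

noncomputable section

/-- A square matrix of odd size with `A i j = 0` whenever `i + j` is even has zero determinant:
conjugating by the diagonal matrix of alternating signs negates it. -/
theorem det_eq_zero_of_odd_of_checkerboard {n : ℕ} (hn : Odd n) (A : Matrix (Fin n) (Fin n) ℝ)
    (hA : ∀ i j : Fin n, Even (i.val + j.val) → A i j = 0) : A.det = 0 := by
  have hconj : diagonal (fun i : Fin n => (-1 : ℝ) ^ i.val) * A *
      diagonal (fun i : Fin n => (-1 : ℝ) ^ i.val) = -A := by
    ext i j
    rw [mul_diagonal, diagonal_mul, neg_apply, mul_right_comm, ← pow_add]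
    rcases Nat.even_or_odd (i.val + j.val) with h | h
    · simp [hA i j h]
    · simp [h.neg_one_pow]
  have hsign : (∏ i : Fin n, (-1 : ℝ) ^ i.val) * (∏ i : Fin n, (-1 : ℝ) ^ i.val) = 1 := by
    rw [← Finset.prod_mul_distrib]
    exact Finset.prod_eq_one fun i _ => by rw [← mul_pow]; norm_num
  have hdet := congrArg det hconj
  rw [det_mul, det_mul, det_diagonal, mul_right_comm, hsign, det_neg, Fintype.card_fin,
    hn.neg_one_pow] at hdet
  linarith

/-- for every real `t` the shifted matrix `H^{(11)}(t,−t,t,−t) − 2I` is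
singular, i.e. `det(H − 2I) = 0`; equivalently `E = 0` is a `t`-independent eigenvalue
of the shifted Hamiltonian. -/
theorem zero_eigenvalue_t_independent (t : ℝ) :
    (H11 t t t t - 2).det = 0 := by
  refine det_eq_zero_of_odd_of_checkerboard (by decide) _ fun i j hij => ?_
  obtain ⟨k, hk⟩ := hij
  rw [Matrix.sub_apply, ← diagonal_ofNat, diagonal_apply]
  by_cases h : i = j
  · simp [H11, h]
  · have h₁ : ¬ j.val = i.val + 1 := by omega
    have h₂ : ¬ i.val = j.val + 1 := by omega
    simp [H11, h, h₁, h₂]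
end
end
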